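/- arXiv:2503.13700 — 6 statements merged into one kernel-verified Lean document; each statement's English description precedes it below -/
import Mathlib

section
/- Let 𝒯 be a triangulated category, A, B objects of 𝒯 and n ≥ 1. The Ext-class map is surjective: for every morphism f : A → B⟦n⟧ in 𝒯 there exists an n-extension ℰ from A to B whose Ext-class satisfies φ(ℰ) = f. -/
open CategoryTheory Category Limits Pretriangulated

variable (𝒯 : Type*) [Category 𝒯] [HasZeroObject 𝒯] [HasShift 𝒯 ℤ] [Preadditive 𝒯]
  [∀ n : ℤ, (shiftFunctor 𝒯 n).Additive] [Pretriangulated 𝒯] [IsTriangulated 𝒯]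

/-- A (Yoneda) `n`-extension from `A` to `B` in a triangulated category `𝒯`:
objects `C 0, …, C n` and `E 0, …, E (n-1)` with `C 0 = B`, `C n = A`, together with
distinguished triangles `C i → E i → C (i+1) →φ_i (C i)⟦1⟧` for `i = 0, …, n-1`. -/
structure NExt (n : ℕ) (A B : 𝒯) where
  C : ℕ → 𝒯
  E : ℕ → 𝒯
  hC0 : C 0 = B
  hCn : C n = A
  u : ∀ i, C i ⟶ E i
  v : ∀ i, E i ⟶ C (i + 1)
  φ : ∀ i, C (i + 1) ⟶ (C i)⟦(1 : ℤ)⟧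
  mem : ∀ i < n, Triangle.mk (u i) (v i) (φ i) ∈ distTriang 𝒯

variable {𝒯}

/-- The partial Ext-classes `ψ_i = φ_0⟦i-1⟧ ∘ ⋯ ∘ φ_{i-1} : C i ⟶ (C 0)⟦i⟧`, composing
the connecting morphisms and identifying iterated shifts via the canonical isomorphisms. -/
def NExt.psi {n : ℕ} {A B : 𝒯} (ℰ : NExt 𝒯 n A B) :
    ∀ i : ℕ, (ℰ.C i ⟶ (ℰ.C 0)⟦(i : ℤ)⟧)
  | 0 => (shiftFunctorZero' 𝒯 ((0 : ℕ) : ℤ) (by simp)).inv.app (ℰ.C 0)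
  | (i + 1) =>
      ℰ.φ i ≫ (ℰ.psi i)⟦(1 : ℤ)⟧' ≫
        (shiftFunctorAdd' 𝒯 (i : ℤ) (1 : ℤ) ((i + 1 : ℕ) : ℤ)
          (by push_cast; ring)).inv.app (ℰ.C 0)

/-- The Ext-class `φ(ℰ) = φ_0⟦n-1⟧ ∘ φ_1⟦n-2⟧ ∘ ⋯ ∘ φ_{n-1} : A ⟶ B⟦n⟧` of an
`n`-extension. -/
def NExt.extClass {n : ℕ} {A B : 𝒯} (ℰ : NExt 𝒯 n A B) : A ⟶ B⟦(n : ℤ)⟧ :=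
  eqToHom ℰ.hCn.symm ≫ ℰ.psi n ≫ (shiftFunctor 𝒯 ((n : ℕ) : ℤ)).map (eqToHom ℰ.hC0)

set_option linter.unusedSectionVars false

lemma shiftFunctorZero'_inv_app_shift_comp
    {D : Type*} [Category D] [HasShift D ℤ] (B : D) {a : ℤ} (ha : a = 0) (h : a + 1 = 1) :
    ((shiftFunctorZero' D a ha).inv.app B)⟦(1 : ℤ)⟧' ≫
      (shiftFunctorAdd' D a 1 1 h).inv.app B = 𝟙 _ := by
  subst ha
  simp [shiftFunctorZero', shiftFunctorAdd'_zero_add_inv_app, ← Functor.map_comp]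

lemma shiftFunctorZero'_inv_app_comp_shiftFunctorAdd'_inv_app
    {D : Type*} [Category D] [HasShift D ℤ] (B : D) {a b : ℤ} (ha : a = 0)
    (h : a + 1 = b) (h' : 1 + a = b) :
    ((shiftFunctorZero' D a ha).inv.app B)⟦(1 : ℤ)⟧' ≫
        (shiftFunctorAdd' D a 1 b h).inv.app B =
      (shiftFunctorZero' D a ha).inv.app (B⟦(1 : ℤ)⟧) ≫
        (shiftFunctorAdd' D 1 a b h').inv.app B := by
  obtain rfl : b = 1 := by omega
  rw [shiftFunctorZero'_inv_app_shift_comp]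
  subst ha
  simp [shiftFunctorZero', shiftFunctorAdd'_add_zero_inv_app]

/-- The `1`-extension defined by a distinguished triangle `B ⟶ E ⟶ A ⟶ B⟦1⟧`. -/
def NExt.ofTriangle {A B E : 𝒯} (u : B ⟶ E) (v : E ⟶ A) (f : A ⟶ B⟦(1 : ℤ)⟧)
    (h : Triangle.mk u v f ∈ distTriang 𝒯) : NExt 𝒯 1 A B where
  C i := Nat.casesOn i B fun _ => A
  E i := Nat.casesOn i E fun _ => E
  hC0 := rfl
  hCn := rfl
  u i := Nat.casesOn i u fun _ => 0
  v i := Nat.casesOn i v fun _ => 0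
  φ i := Nat.casesOn i f fun _ => 0
  mem i hi := by
    obtain rfl : i = 0 := by omega
    exact h

lemma NExt.extClass_ofTriangle {A B E : 𝒯} (u : B ⟶ E) (v : E ⟶ A) (f : A ⟶ B⟦(1 : ℤ)⟧)
    (h : Triangle.mk u v f ∈ distTriang 𝒯) : (NExt.ofTriangle u v f h).extClass = f := by
  have h₁ : (NExt.ofTriangle u v f h).psi 1 = f :=
    (congrArg (f ≫ ·) (shiftFunctorZero'_inv_app_shift_comp B (a := ((0 : ℕ) : ℤ))
      (by simp) (by simp))).trans (comp_id f)
  have h₂ : (NExt.ofTriangle u v f h).extClass =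
      𝟙 A ≫ (NExt.ofTriangle u v f h).psi 1 ≫
        (𝟙 ((NExt.ofTriangle u v f h).C 0))⟦((1 : ℕ) : ℤ)⟧' := rfl
  rw [h₂, CategoryTheory.Functor.map_id]
  erw [comp_id, id_comp]
  exact h₁

/-- Splice a distinguished triangle `B ⟶ F ⟶ X ⟶ B⟦1⟧` to the left of an `n`-extension
from `A` to `X`. -/
def NExt.cons {n : ℕ} {A X B F : 𝒯} (ℰ : NExt 𝒯 n A X) (u : B ⟶ F) (v : F ⟶ X)
    (g : X ⟶ B⟦(1 : ℤ)⟧) (h : Triangle.mk u v g ∈ distTriang 𝒯) : NExt 𝒯 (n + 1) A B where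
  C i := Nat.casesOn i B ℰ.C
  E i := Nat.casesOn i F ℰ.E
  hC0 := rfl
  hCn := ℰ.hCn
  u i := Nat.casesOn i u ℰ.u
  v i := Nat.casesOn i (v ≫ eqToHom ℰ.hC0.symm) ℰ.v
  φ i := Nat.casesOn i (eqToHom ℰ.hC0 ≫ g) ℰ.φ
  mem i hi := by
    cases i with
    | zero =>
      obtain ⟨C, E, rfl, _⟩ := ℰ
      simpa using h
    | succ i => exact ℰ.mem i (by omega)

lemma NExt.psi_cons {n : ℕ} {A X B F : 𝒯} (ℰ : NExt 𝒯 n A X) (u : B ⟶ F) (v : F ⟶ X)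
    (g : X ⟶ B⟦(1 : ℤ)⟧) (h : Triangle.mk u v g ∈ distTriang 𝒯) (i : ℕ) :
    (ℰ.cons u v g h).psi (i + 1) =
      ℰ.psi i ≫ (eqToHom ℰ.hC0 ≫ g)⟦(i : ℤ)⟧' ≫
        (shiftFunctorAdd' 𝒯 (1 : ℤ) (i : ℤ) ((i + 1 : ℕ) : ℤ)
          (by push_cast; ring)).inv.app B := by
  induction i with
  | zero =>
    change (eqToHom ℰ.hC0 ≫ g) ≫
      ((shiftFunctorZero' 𝒯 ((0 : ℕ) : ℤ) (by simp)).inv.app B)⟦(1 : ℤ)⟧' ≫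
        (shiftFunctorAdd' 𝒯 ((0 : ℕ) : ℤ) 1 ((0 + 1 : ℕ) : ℤ) (by simp)).inv.app B =
      (shiftFunctorZero' 𝒯 ((0 : ℕ) : ℤ) (by simp)).inv.app (ℰ.C 0) ≫
        (eqToHom ℰ.hC0 ≫ g)⟦((0 : ℕ) : ℤ)⟧' ≫
          (shiftFunctorAdd' 𝒯 1 ((0 : ℕ) : ℤ) ((0 + 1 : ℕ) : ℤ) (by simp)).inv.app B
    have nat := (shiftFunctorZero' 𝒯 ((0 : ℕ) : ℤ) (by simp)).inv.naturality
      (eqToHom ℰ.hC0 ≫ g)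
    dsimp only [Functor.id_map, Functor.id_obj] at nat
    rw [shiftFunctorZero'_inv_app_comp_shiftFunctorAdd'_inv_app B (h' := by simp),
      ← reassoc_of% nat, assoc]
  | succ i ih =>
    change ℰ.φ i ≫ ((ℰ.cons u v g h).psi (i + 1))⟦(1 : ℤ)⟧' ≫
      (shiftFunctorAdd' 𝒯 ((i + 1 : ℕ) : ℤ) (1 : ℤ) ((i + 1 + 1 : ℕ) : ℤ)
        (by push_cast; ring)).inv.app B = _
    rw [ih, NExt.psi]
    simp only [Functor.map_comp, assoc]
    have e := shiftFunctorAdd'_assoc_inv_app (C := 𝒯) (1 : ℤ) (i : ℤ) 1 ((i + 1 : ℕ) : ℤ)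
      ((i + 1 : ℕ) : ℤ) ((i + 1 + 1 : ℕ) : ℤ) (by push_cast; ring) (by push_cast; ring)
      (by push_cast; ring) B
    have nat {Y Z : 𝒯} (k : Y ⟶ Z) := (shiftFunctorAdd' 𝒯 (i : ℤ) 1 ((i + 1 : ℕ) : ℤ)
      (by push_cast; ring)).inv.naturality k
    dsimp only [Functor.comp_map, Functor.comp_obj] at nat
    rw [← reassoc_of% (nat (eqToHom ℰ.hC0)), ← reassoc_of% (nat g), ← e]
    simp only [← Functor.map_comp_assoc]
    rfl

lemma NExt.extClass_cons {n : ℕ} {A X B F : 𝒯} (ℰ : NExt 𝒯 n A X) (u : B ⟶ F) (v : F ⟶ X)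
    (g : X ⟶ B⟦(1 : ℤ)⟧) (h : Triangle.mk u v g ∈ distTriang 𝒯) :
    (ℰ.cons u v g h).extClass =
      ℰ.extClass ≫ g⟦(n : ℤ)⟧' ≫
        (shiftFunctorAdd' 𝒯 (1 : ℤ) (n : ℤ) ((n + 1 : ℕ) : ℤ)
          (by push_cast; ring)).inv.app B := by
  have h₁ : (ℰ.cons u v g h).extClass =
      eqToHom ℰ.hCn.symm ≫ (ℰ.cons u v g h).psi (n + 1) ≫
        (𝟙 ((ℰ.cons u v g h).C 0))⟦((n + 1 : ℕ) : ℤ)⟧' := rfl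
  rw [h₁, CategoryTheory.Functor.map_id]
  erw [comp_id]
  rw [NExt.psi_cons, NExt.extClass]
  simp only [Functor.map_comp, assoc]
  rfl

/-- The Ext-class map is surjective: for every `n ≥ 1` and every morphism
`f : A ⟶ B⟦n⟧` in a triangulated category `𝒯`, there exists an `n`-extension `ℰ` from `A`
to `B` with `φ(ℰ) = f`. -/
theorem extClass_surjective {n : ℕ} (hn : 1 ≤ n) (A B : 𝒯) (f : A ⟶ B⟦(n : ℤ)⟧) :
    ∃ ℰ : NExt 𝒯 n A B, ℰ.extClass = f := by
  induction n, hn using Nat.le_induction generalizing B with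
  | base =>
    obtain ⟨E, u, v, h⟩ := distinguished_cocone_triangle₂ (C := 𝒯) (X := B) f
    exact ⟨NExt.ofTriangle u v f h, NExt.extClass_ofTriangle u v f h⟩
  | succ n hn ih =>
    obtain ⟨ℰ, hℰ⟩ := ih (B⟦(1 : ℤ)⟧)
      (f ≫ (shiftFunctorAdd' 𝒯 (1 : ℤ) (n : ℤ) ((n + 1 : ℕ) : ℤ)
        (by push_cast; ring)).hom.app B)
    obtain ⟨E, u, v, h⟩ := distinguished_cocone_triangle₂ (𝟙 (B⟦(1 : ℤ)⟧))
    refine ⟨ℰ.cons u v _ h, ?_⟩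
    rw [NExt.extClass_cons, hℰ, CategoryTheory.Functor.map_id]
    simp
end

section
/- Let (𝒜, 𝒞, ℬ; i, I, Q, K, G) be a recollement of triangulated categories as in the context. Define the natural transformation α : K ⟶ Q whose component at an object X of 𝒞 is the composite K X → K(i(Q X)) → Q X, where the first map is K applied to the unit q_X : X → i(Q X) of Q ⊣ i and the second map is the inverse of the unit isomorphism of i ⊣ K evaluated at Q X. Then for every object X of 𝒞 there exists a morphism β_X : Q X → (K(G(I X)))⟦1⟧ such that K(G(I X)) →K(ξ_X) K X →α_X Q X →β_X (K(G(I X)))⟦1⟧ is a distinguished triangle in 𝒜, where ξ_X : G(I X) → X is the counit of G ⊣ I. -/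
open CategoryTheory Category Limits Pretriangulated

/-- For a recollement `(𝒜, 𝒞, ℬ; i, I, Q, K, G)` of triangulated
categories, with `α : K ⟶ Q` given at `X` by `K X → K(i(Q X)) → Q X` (apply `K` to the
unit `q_X` of `Q ⊣ i`, then the inverse of the unit of `i ⊣ K` at `Q X`), for every
object `X` of `𝒞` there is a morphism `β_X : Q X ⟶ (K(G(I X)))⟦1⟧` such that
`K(G(I X)) →K(ξ_X) K X →α_X Q X →β_X (K(G(I X)))⟦1⟧` is distinguished in `𝒜`. -/
theorem recollement_triangle_K_Q
    {𝒜 𝒞 ℬ : Type*} [Category 𝒜] [Category 𝒞] [Category ℬ]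
    [HasZeroObject 𝒜] [HasShift 𝒜 ℤ] [Preadditive 𝒜]
    [∀ n : ℤ, (shiftFunctor 𝒜 n).Additive] [Pretriangulated 𝒜] [IsTriangulated 𝒜]
    [HasZeroObject 𝒞] [HasShift 𝒞 ℤ] [Preadditive 𝒞]
    [∀ n : ℤ, (shiftFunctor 𝒞 n).Additive] [Pretriangulated 𝒞] [IsTriangulated 𝒞]
    [HasZeroObject ℬ] [HasShift ℬ ℤ] [Preadditive ℬ]
    [∀ n : ℤ, (shiftFunctor ℬ n).Additive] [Pretriangulated ℬ] [IsTriangulated ℬ]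
    (i : 𝒜 ⥤ 𝒞) (I : 𝒞 ⥤ ℬ) (Q : 𝒞 ⥤ 𝒜) (K : 𝒞 ⥤ 𝒜) (G : ℬ ⥤ 𝒞)
    [i.CommShift ℤ] [I.CommShift ℤ] [Q.CommShift ℤ] [K.CommShift ℤ] [G.CommShift ℤ]
    [i.IsTriangulated] [I.IsTriangulated] [Q.IsTriangulated] [K.IsTriangulated]
    [G.IsTriangulated]
    (adjQi : Q ⊣ i) (adjiK : i ⊣ K) (adjGI : G ⊣ I)
    (hvanish : ∀ a : 𝒜, IsZero (I.obj (i.obj a)))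
    [IsIso adjiK.unit] [IsIso adjQi.counit] [IsIso adjGI.unit]
    (bd : Q ⋙ i ⟶ (I ⋙ G) ⋙ shiftFunctor 𝒞 (1 : ℤ))
    (htri : ∀ X : 𝒞,
      Triangle.mk (adjGI.counit.app X) (adjQi.unit.app X) (bd.app X) ∈ distTriang 𝒞) :
    ∀ X : 𝒞,
      ∃ β : Q.obj X ⟶ (K.obj (G.obj (I.obj X)))⟦(1 : ℤ)⟧,
        Triangle.mk (K.map (adjGI.counit.app X))
          (K.map (adjQi.unit.app X) ≫ inv (adjiK.unit.app (Q.obj X))) β ∈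
          distTriang 𝒜 := by
  intro X
  refine ⟨adjiK.unit.app (Q.obj X) ≫ K.map (bd.app X) ≫
    (K.commShiftIso (1 : ℤ)).hom.app (G.obj (I.obj X)), ?_⟩
  refine isomorphic_distinguished _ (K.map_distinguished _ (htri X)) _ ?_
  let e : Q.obj X ≅ K.obj (i.obj (Q.obj X)) := asIso (adjiK.unit.app (Q.obj X))
  refine Triangle.isoMk _ _ (Iso.refl (K.obj (G.obj (I.obj X)))) (Iso.refl (K.obj X)) e
    ?_ ?_ ?_
  · exact (comp_id _).trans (id_comp _).symm
  · have h : (K.map (adjQi.unit.app X) ≫ inv (adjiK.unit.app (Q.obj X))) ≫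
        adjiK.unit.app (Q.obj X) = K.map (adjQi.unit.app X) := by
      rw [assoc, IsIso.inv_hom_id, comp_id]
    exact h.trans (id_comp _).symm
  · exact (_ ≫= (shiftFunctor 𝒜 (1 : ℤ)).map_id _).trans (comp_id _)
end

section
/- Let 𝒯 be a triangulated category and let (𝒯, 𝒯_ε, 𝒯; i, I, Q, K, G) and (𝒯, 𝒯̃_ε, 𝒯; ĩ, Ĩ, Q̃, K̃, G̃) be two recollements of triangulated categories with outer terms 𝒯, as in the context. Let F : 𝒯_ε ⥤ 𝒯̃_ε be an exact functor. Then the following are equivalent: (a) there exist natural isomorphisms χ_I : I ≅ F ⋙ Ĩ and χ_Q : Q ≅ F ⋙ Q̃; (b) there exist natural transformations u : I ⋙ G̃ ⟶ F and v : F ⟶ Q ⋙ ĩ and, for each object X of 𝒯_ε, a morphism w_X : ĩ(Q X) → (G̃(I X))⟦1⟧ natural in X, such that G̃(I X) →u_X F X →v_X ĩ(Q X) →w_X (G̃(I X))⟦1⟧ is a distinguished triangle for every X. -/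
open CategoryTheory Category Limits Pretriangulated

namespace CategoryTheory.Pretriangulated

variable {C D : Type*} [Category C] [Category D]
  [HasZeroObject C] [HasShift C ℤ] [Preadditive C]
  [∀ n : ℤ, (shiftFunctor C n).Additive] [Pretriangulated C]
  [HasZeroObject D] [HasShift D ℤ] [Preadditive D]
  [∀ n : ℤ, (shiftFunctor D n).Additive] [Pretriangulated D]

/-- An exact functor which kills the third object of a distinguished triangle inverts its first
morphism. -/
lemma isIso_map_mor₁_of_isZero (H : C ⥤ D) [H.CommShift ℤ] [H.IsTriangulated]
    {T : Triangle C} (hT : T ∈ distTriang C) (h : IsZero (H.obj T.obj₃)) :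
    IsIso (H.map T.mor₁) :=
  (Triangle.isZero₃_iff_isIso₁ _ (H.map_distinguished T hT)).1 h

/-- An exact functor which kills the first object of a distinguished triangle inverts its second
morphism. -/
lemma isIso_map_mor₂_of_isZero (H : C ⥤ D) [H.CommShift ℤ] [H.IsTriangulated]
    {T : Triangle C} (hT : T ∈ distTriang C) (h : IsZero (H.obj T.obj₁)) :
    IsIso (H.map T.mor₂) :=
  (Triangle.isZero₁_iff_isIso₂ _ (H.map_distinguished T hT)).1 h

/-- Distinguished triangles may be transported along isomorphisms of their outer objects. -/
lemma mk_comp_iso_mem_distTriang {X Y Z X' Z' : C} {f : X ⟶ Y} {g : Y ⟶ Z} {h : Z ⟶ X⟦(1 : ℤ)⟧}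
    (hT : Triangle.mk f g h ∈ distTriang C) (e₁ : X' ≅ X) (e₃ : Z' ≅ Z) :
    Triangle.mk (e₁.hom ≫ f) (g ≫ e₃.inv) (e₃.hom ≫ h ≫ e₁.inv⟦(1 : ℤ)⟧') ∈ distTriang C :=
  isomorphic_distinguished _ hT _
    (Triangle.isoMk _ _ e₁ (Iso.refl Y) e₃ (comp_id (e₁.hom ≫ f))
      (show (g ≫ e₃.inv) ≫ e₃.hom = 𝟙 Y ≫ g by simp)
      (show (e₃.hom ≫ h ≫ e₁.inv⟦(1 : ℤ)⟧') ≫ e₁.hom⟦(1 : ℤ)⟧' = e₃.hom ≫ h by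
        simp [← Functor.map_comp]))

end CategoryTheory.Pretriangulated

/-- If `G ⊣ I`, `Q ⊣ i` and `I` vanishes on the image of `i`, then `Q` vanishes on the image
of `G`. -/
lemma CategoryTheory.Adjunction.isZero_obj_obj_of_isZero
    {A B C : Type*} [Category A] [Category B] [Category C]
    {i : A ⥤ C} {I : C ⥤ B} {Q : C ⥤ A} {G : B ⥤ C} (adjQi : Q ⊣ i) (adjGI : G ⊣ I)
    [HasZeroMorphisms A] (hvanish : ∀ a : A, IsZero (I.obj (i.obj a))) (b : B) :
    IsZero (Q.obj (G.obj b)) := by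
  rw [IsZero.iff_id_eq_zero]
  apply (adjQi.homEquiv _ _).injective
  apply (adjGI.homEquiv _ _).injective
  exact (hvanish _).eq_of_tgt _ _

/-- Let `(𝒯, 𝒞, 𝒯; i, I, Q, K, G)` and `(𝒯, 𝒟, 𝒯; i', I', Q', K', G')`
be two recollements of triangulated categories with outer terms `𝒯`, and let `F : 𝒞 ⥤ 𝒟`
be an exact functor. The following are equivalent: (a) there exist natural isomorphisms
`χ_I : I ≅ F ⋙ I'` and `χ_Q : Q ≅ F ⋙ Q'`; (b) there exist natural transformations
`u : I ⋙ G' ⟶ F` and `v : F ⟶ Q ⋙ i'` and morphisms `w_X : i'(Q X) ⟶ (G'(I X))⟦1⟧`,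
natural in `X`, such that `G'(I X) →u_X F X →v_X i'(Q X) →w_X (G'(I X))⟦1⟧` is a
distinguished triangle for every `X`. -/
theorem compatible_with_sod_iff_triangle
    {𝒯 𝒞 𝒟 : Type*} [Category 𝒯] [Category 𝒞] [Category 𝒟]
    [HasZeroObject 𝒯] [HasShift 𝒯 ℤ] [Preadditive 𝒯]
    [∀ n : ℤ, (shiftFunctor 𝒯 n).Additive] [Pretriangulated 𝒯] [IsTriangulated 𝒯]
    [HasZeroObject 𝒞] [HasShift 𝒞 ℤ] [Preadditive 𝒞]
    [∀ n : ℤ, (shiftFunctor 𝒞 n).Additive] [Pretriangulated 𝒞] [IsTriangulated 𝒞]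
    [HasZeroObject 𝒟] [HasShift 𝒟 ℤ] [Preadditive 𝒟]
    [∀ n : ℤ, (shiftFunctor 𝒟 n).Additive] [Pretriangulated 𝒟] [IsTriangulated 𝒟]
    -- the first recollement, with middle term `𝒞`
    (i : 𝒯 ⥤ 𝒞) (I : 𝒞 ⥤ 𝒯) (Q : 𝒞 ⥤ 𝒯) (K : 𝒞 ⥤ 𝒯) (G : 𝒯 ⥤ 𝒞)
    [i.CommShift ℤ] [I.CommShift ℤ] [Q.CommShift ℤ] [K.CommShift ℤ] [G.CommShift ℤ]
    [i.IsTriangulated] [I.IsTriangulated] [Q.IsTriangulated] [K.IsTriangulated]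
    [G.IsTriangulated]
    (adjQi : Q ⊣ i) (adjiK : i ⊣ K) (adjGI : G ⊣ I)
    (hvanish : ∀ a : 𝒯, IsZero (I.obj (i.obj a)))
    [IsIso adjiK.unit] [IsIso adjQi.counit] [IsIso adjGI.unit]
    (bd : Q ⋙ i ⟶ (I ⋙ G) ⋙ shiftFunctor 𝒞 (1 : ℤ))
    (htri : ∀ X : 𝒞,
      Triangle.mk (adjGI.counit.app X) (adjQi.unit.app X) (bd.app X) ∈ distTriang 𝒞)
    -- the second recollement, with middle term `𝒟`
    (i' : 𝒯 ⥤ 𝒟) (I' : 𝒟 ⥤ 𝒯) (Q' : 𝒟 ⥤ 𝒯) (K' : 𝒟 ⥤ 𝒯) (G' : 𝒯 ⥤ 𝒟)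
    [i'.CommShift ℤ] [I'.CommShift ℤ] [Q'.CommShift ℤ] [K'.CommShift ℤ] [G'.CommShift ℤ]
    [i'.IsTriangulated] [I'.IsTriangulated] [Q'.IsTriangulated] [K'.IsTriangulated]
    [G'.IsTriangulated]
    (adjQi' : Q' ⊣ i') (adjiK' : i' ⊣ K') (adjGI' : G' ⊣ I')
    (hvanish' : ∀ a : 𝒯, IsZero (I'.obj (i'.obj a)))
    [IsIso adjiK'.unit] [IsIso adjQi'.counit] [IsIso adjGI'.unit]
    (bd' : Q' ⋙ i' ⟶ (I' ⋙ G') ⋙ shiftFunctor 𝒟 (1 : ℤ))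
    (htri' : ∀ X : 𝒟,
      Triangle.mk (adjGI'.counit.app X) (adjQi'.unit.app X) (bd'.app X) ∈ distTriang 𝒟)
    -- an exact functor between the middle terms
    (F : 𝒞 ⥤ 𝒟) [F.CommShift ℤ] [F.IsTriangulated] :
    (Nonempty (I ≅ F ⋙ I') ∧ Nonempty (Q ≅ F ⋙ Q')) ↔
      (∃ (u : I ⋙ G' ⟶ F) (v : F ⟶ Q ⋙ i')
          (w : Q ⋙ i' ⟶ (I ⋙ G') ⋙ shiftFunctor 𝒟 (1 : ℤ)),
        ∀ X : 𝒞, Triangle.mk (u.app X) (v.app X) (w.app X) ∈ distTriang 𝒟) := by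
  constructor
  · rintro ⟨⟨χI⟩, ⟨χQ⟩⟩
    refine ⟨Functor.whiskerRight χI.hom G' ≫ Functor.whiskerLeft F adjGI'.counit,
      Functor.whiskerLeft F adjQi'.unit ≫ Functor.whiskerRight χQ.inv i',
      Functor.whiskerRight χQ.hom i' ≫ Functor.whiskerLeft F bd' ≫
        Functor.whiskerRight (Functor.whiskerRight χI.inv G') (shiftFunctor 𝒟 (1 : ℤ)),
      fun X => mk_comp_iso_mem_distTriang (htri' (F.obj X))
        (G'.mapIso (χI.app X)) (i'.mapIso (χQ.app X))⟩
  · rintro ⟨u, v, w, h⟩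
    have hu (X : 𝒞) : IsIso (I'.map (u.app X)) :=
      isIso_map_mor₁_of_isZero I' (h X) (hvanish' _)
    have hv (X : 𝒞) : IsIso (Q'.map (v.app X)) :=
      isIso_map_mor₂_of_isZero Q' (h X) (adjQi'.isZero_obj_obj_of_isZero adjGI' hvanish' _)
    have : ∀ X, IsIso ((Functor.whiskerRight u I').app X) := hu
    have : ∀ X, IsIso ((Functor.whiskerRight v Q').app X) := hv
    have := NatIso.isIso_of_isIso_app (Functor.whiskerRight u I')
    have := NatIso.isIso_of_isIso_app (Functor.whiskerRight v Q')
    exact ⟨⟨Functor.isoWhiskerLeft I (asIso adjGI'.unit) ≪≫ asIso (Functor.whiskerRight u I')⟩,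
      ⟨(asIso (Functor.whiskerRight v Q') ≪≫
        Functor.isoWhiskerLeft Q (asIso adjQi'.counit)).symm⟩⟩
end

section
/- Let 𝒯 be a triangulated category and let (𝒯, 𝒯_ε, 𝒯; i, I, Q, K, G) and (𝒯, 𝒯̃_ε, 𝒯; ĩ, Ĩ, Q̃, K̃, G̃) be two recollements of triangulated categories with outer terms 𝒯, as in the context. Let F : 𝒯_ε ⥤ 𝒯̃_ε be an exact functor which is compatible with the semiorthogonal decompositions, in the sense that there exist natural transformations u : I ⋙ G̃ ⟶ F and v : F ⟶ Q ⋙ ĩ and morphisms w_X : ĩ(Q X) → (G̃(I X))⟦1⟧, natural in X, such that G̃(I X) →u_X F X →v_X ĩ(Q X) →w_X (G̃(I X))⟦1⟧ is a distinguished triangle for every object X of 𝒯_ε. Then there exist natural isomorphisms χ_G : G̃ ≅ G ⋙ F and χ_i : ĩ ≅ i ⋙ F. -/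
open CategoryTheory Category Limits Pretriangulated

/-- Let `(𝒯, 𝒞, 𝒯; i, I, Q, K, G)` and `(𝒯, 𝒟, 𝒯; i', I', Q', K', G')`
be two recollements of triangulated categories with outer terms `𝒯`, and let `F : 𝒞 ⥤ 𝒟`
be an exact functor compatible with the semiorthogonal decompositions, i.e. there are
natural transformations `u : I ⋙ G' ⟶ F`, `v : F ⟶ Q ⋙ i'` and morphisms
`w_X : i'(Q X) ⟶ (G'(I X))⟦1⟧` natural in `X` such that
`G'(I X) →u_X F X →v_X i'(Q X) →w_X (G'(I X))⟦1⟧` is distinguished for every `X`.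
Then there exist natural isomorphisms `χ_G : G' ≅ G ⋙ F` and `χ_i : i' ≅ i ⋙ F`. -/
theorem compatible_with_sod_isos
    {𝒯 𝒞 𝒟 : Type*} [Category 𝒯] [Category 𝒞] [Category 𝒟]
    [HasZeroObject 𝒯] [HasShift 𝒯 ℤ] [Preadditive 𝒯]
    [∀ n : ℤ, (shiftFunctor 𝒯 n).Additive] [Pretriangulated 𝒯] [IsTriangulated 𝒯]
    [HasZeroObject 𝒞] [HasShift 𝒞 ℤ] [Preadditive 𝒞]
    [∀ n : ℤ, (shiftFunctor 𝒞 n).Additive] [Pretriangulated 𝒞] [IsTriangulated 𝒞]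
    [HasZeroObject 𝒟] [HasShift 𝒟 ℤ] [Preadditive 𝒟]
    [∀ n : ℤ, (shiftFunctor 𝒟 n).Additive] [Pretriangulated 𝒟] [IsTriangulated 𝒟]
    -- the first recollement, with middle term `𝒞`
    (i : 𝒯 ⥤ 𝒞) (I : 𝒞 ⥤ 𝒯) (Q : 𝒞 ⥤ 𝒯) (K : 𝒞 ⥤ 𝒯) (G : 𝒯 ⥤ 𝒞)
    [i.CommShift ℤ] [I.CommShift ℤ] [Q.CommShift ℤ] [K.CommShift ℤ] [G.CommShift ℤ]
    [i.IsTriangulated] [I.IsTriangulated] [Q.IsTriangulated] [K.IsTriangulated]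
    [G.IsTriangulated]
    (adjQi : Q ⊣ i) (adjiK : i ⊣ K) (adjGI : G ⊣ I)
    (hvanish : ∀ a : 𝒯, IsZero (I.obj (i.obj a)))
    [IsIso adjiK.unit] [IsIso adjQi.counit] [IsIso adjGI.unit]
    (bd : Q ⋙ i ⟶ (I ⋙ G) ⋙ shiftFunctor 𝒞 (1 : ℤ))
    (htri : ∀ X : 𝒞,
      Triangle.mk (adjGI.counit.app X) (adjQi.unit.app X) (bd.app X) ∈ distTriang 𝒞)
    -- the second recollement, with middle term `𝒟`
    (i' : 𝒯 ⥤ 𝒟) (I' : 𝒟 ⥤ 𝒯) (Q' : 𝒟 ⥤ 𝒯) (K' : 𝒟 ⥤ 𝒯) (G' : 𝒯 ⥤ 𝒟)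
    [i'.CommShift ℤ] [I'.CommShift ℤ] [Q'.CommShift ℤ] [K'.CommShift ℤ] [G'.CommShift ℤ]
    [i'.IsTriangulated] [I'.IsTriangulated] [Q'.IsTriangulated] [K'.IsTriangulated]
    [G'.IsTriangulated]
    (adjQi' : Q' ⊣ i') (adjiK' : i' ⊣ K') (adjGI' : G' ⊣ I')
    (hvanish' : ∀ a : 𝒯, IsZero (I'.obj (i'.obj a)))
    [IsIso adjiK'.unit] [IsIso adjQi'.counit] [IsIso adjGI'.unit]
    (bd' : Q' ⋙ i' ⟶ (I' ⋙ G') ⋙ shiftFunctor 𝒟 (1 : ℤ))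
    (htri' : ∀ X : 𝒟,
      Triangle.mk (adjGI'.counit.app X) (adjQi'.unit.app X) (bd'.app X) ∈ distTriang 𝒟)
    -- an exact functor between the middle terms, compatible with the SODs
    (F : 𝒞 ⥤ 𝒟) [F.CommShift ℤ] [F.IsTriangulated]
    (u : I ⋙ G' ⟶ F) (v : F ⟶ Q ⋙ i')
    (w : Q ⋙ i' ⟶ (I ⋙ G') ⋙ shiftFunctor 𝒟 (1 : ℤ))
    (hF : ∀ X : 𝒞, Triangle.mk (u.app X) (v.app X) (w.app X) ∈ distTriang 𝒟) :
    Nonempty (G' ≅ G ⋙ F) ∧ Nonempty (i' ≅ i ⋙ F) := by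
  have hQG (b : 𝒯) : IsZero (Q.obj (G.obj b)) := by
    rw [IsZero.iff_id_eq_zero]
    exact ((adjQi.homEquiv _ _).trans (adjGI.homEquiv _ _)).injective
      ((hvanish _).eq_of_tgt _ _)
  have hu (b : 𝒯) : IsIso (u.app (G.obj b)) :=
    (Triangle.isZero₃_iff_isIso₁ _ (hF (G.obj b))).1 (i'.map_isZero (hQG b))
  have hv (a : 𝒯) : IsIso (v.app (i.obj a)) :=
    (Triangle.isZero₁_iff_isIso₂ _ (hF (i.obj a))).1 (G'.map_isZero (hvanish a))
  have : IsIso (Functor.whiskerLeft G u) := by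
    rw [NatTrans.isIso_iff_isIso_app]
    exact hu
  have : IsIso (Functor.whiskerLeft i v) := by
    rw [NatTrans.isIso_iff_isIso_app]
    exact hv
  exact ⟨⟨G'.leftUnitor.symm ≪≫ Functor.isoWhiskerRight (asIso adjGI.unit) G' ≪≫
      Functor.associator G I G' ≪≫ asIso (Functor.whiskerLeft G u)⟩,
    ⟨i'.leftUnitor.symm ≪≫ Functor.isoWhiskerRight (asIso adjQi.counit).symm i' ≪≫
      Functor.associator i Q i' ≪≫ (asIso (Functor.whiskerLeft i v)).symm⟩⟩
end

section
/- Let 𝒯 be a triangulated category, (𝒯, 𝒯_ε, 𝒯; i, I, Q, K, G) a recollement with outer terms 𝒯 as in the context, with unit isomorphism g : 1_𝒯 ≅ G ⋙ I (components g_Y : Y → I(G Y)). Suppose that for every object X of 𝒯_ε we are given data as in a categorical deformation: morphisms γ_X, α_X, β_X with K(G(I X)) →γ_X K X →α_X Q X →β_X (K(G(I X)))⟦1⟧ distinguished, an object C_X and morphisms δ₁, ζ₁, η₁, η₂, δ₂, ζ₂ with I X →δ₁ K X →ζ₁ C_X →η₁ (I X)⟦1⟧ and C_X →η₂ Q X →δ₂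 I X →ζ₂ C_X⟦1⟧ distinguished and η₂ ∘ ζ₁ = α_X; set ι_X := η₁ ∘ ζ₂⟦−1⟧ : (I X)⟦−1⟧ → (I X)⟦1⟧. For an object Y of 𝒯 define μ_Y := ((g_Y)⟦1⟧)⁻¹ ∘ ι_{G Y} ∘ (g_Y)⟦−1⟧ : Y⟦−1⟧ → Y⟦1⟧. Then for every object Y of 𝒯 there exist morphisms s_Y : Y⟦1⟧ → (K(G Y))⟦1⟧ and p_Y : (K(G Y))⟦1⟧ → Y such that Y⟦−1⟧ →μ_Y Y⟦1⟧ →s_Y (K(G Y))⟦1⟧ →p_Y Y is a distinguished triangle in 𝒯. -/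
open CategoryTheory Category Limits Pretriangulated

/-- The left adjoint `Q` of `i` kills the image of the left adjoint `G` of `I` as soon as
`I` vanishes on the image of `i`. -/
theorem isZero_leftAdjoint_obj_leftAdjoint_obj {𝒜 𝒞 ℬ : Type*} [Category 𝒜] [Category 𝒞]
    [Category ℬ] [HasZeroMorphisms 𝒜] [HasZeroMorphisms ℬ]
    {i : 𝒜 ⥤ 𝒞} {I : 𝒞 ⥤ ℬ} {Q : 𝒞 ⥤ 𝒜} {G : ℬ ⥤ 𝒞} (adjQi : Q ⊣ i) (adjGI : G ⊣ I)
    (hvanish : ∀ a : 𝒜, IsZero (I.obj (i.obj a))) (Y : ℬ) : IsZero (Q.obj (G.obj Y)) := by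
  rw [IsZero.iff_id_eq_zero]
  apply (adjQi.homEquiv _ _).injective
  apply (adjGI.homEquiv _ _).injective
  exact (hvanish _).eq_of_tgt _ _

/-- If `X ⟶ Y ⟶ Z ⟶ X⟦1⟧` is distinguished, `a : A ≅ Z` and `b : B ≅ X⟦1⟧`, then the
composite `A ≅ Z ⟶ X⟦1⟧ ≅ B` has cone `Y⟦1⟧`. -/
theorem exists_distinguished_of_iso_rotate_rotate {𝒯 : Type*} [Category 𝒯]
    [HasZeroObject 𝒯] [HasShift 𝒯 ℤ] [Preadditive 𝒯]
    [∀ n : ℤ, (shiftFunctor 𝒯 n).Additive] [Pretriangulated 𝒯]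
    {X Y Z : 𝒯} {f : X ⟶ Y} {g : Y ⟶ Z} {h : Z ⟶ X⟦(1 : ℤ)⟧}
    (hT : Triangle.mk f g h ∈ distTriang 𝒯) {A B : 𝒯} (a : A ≅ Z) (b : B ≅ X⟦(1 : ℤ)⟧) :
    ∃ (s : B ⟶ Y⟦(1 : ℤ)⟧) (t : Y⟦(1 : ℤ)⟧ ⟶ A⟦(1 : ℤ)⟧),
      Triangle.mk (a.hom ≫ h ≫ b.inv) s t ∈ distTriang 𝒯 := by
  have hrot : Triangle.mk h (-f⟦(1 : ℤ)⟧') (-g⟦(1 : ℤ)⟧') ∈ distTriang 𝒯 :=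
    rot_of_distTriang _ (rot_of_distTriang _ hT)
  refine ⟨b.hom ≫ (-f⟦(1 : ℤ)⟧'), (-g⟦(1 : ℤ)⟧') ≫ a.inv⟦(1 : ℤ)⟧',
    isomorphic_distinguished _ hrot _ (Triangle.isoMk _ _ a b (Iso.refl _) ?_ ?_ ?_)⟩
  · change (a.hom ≫ h ≫ b.inv) ≫ b.hom = a.hom ≫ h
    simp
  · change (b.hom ≫ (-f⟦(1 : ℤ)⟧')) ≫ 𝟙 _ = b.hom ≫ (-f⟦(1 : ℤ)⟧')
    simp
  · change ((-g⟦(1 : ℤ)⟧') ≫ a.inv⟦(1 : ℤ)⟧') ≫ a.hom⟦(1 : ℤ)⟧' = 𝟙 _ ≫ (-g⟦(1 : ℤ)⟧')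
    simp [← Functor.map_comp]

/-- Let `(𝒯, 𝒞, 𝒯; i, I, Q, K, G)` be a recollement with outer terms `𝒯`
whose unit `g : 𝟭 𝒯 ⟶ G ⋙ I` is an isomorphism, equipped for every object `X` of `𝒞`
with the data of a categorical deformation: distinguished triangles
`K(G(I X)) →γ K X →α Q X →β (K(G(I X)))⟦1⟧`, `I X →δ₁ K X →ζ₁ C_X →η₁ (I X)⟦1⟧` and
`C_X →η₂ Q X →δ₂ I X →ζ₂ C_X⟦1⟧` with `η₂ ∘ ζ₁ = α`; set `ι_X := η₁ ∘ ζ₂⟦-1⟧` and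
`μ_Y := ((g_Y)⟦1⟧)⁻¹ ∘ ι_{G Y} ∘ (g_Y)⟦-1⟧ : Y⟦-1⟧ ⟶ Y⟦1⟧`. Then for every object `Y`
of `𝒯` there are morphisms `s_Y : Y⟦1⟧ ⟶ (K(G Y))⟦1⟧` and `p_Y : (K(G Y))⟦1⟧ ⟶ Y` such
that `Y⟦-1⟧ →μ_Y Y⟦1⟧ →s_Y (K(G Y))⟦1⟧ →p_Y Y` is a distinguished triangle in `𝒯`. -/
theorem deformation_class_triangle
    {𝒯 𝒞 : Type*} [Category 𝒯] [Category 𝒞]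
    [HasZeroObject 𝒯] [HasShift 𝒯 ℤ] [Preadditive 𝒯]
    [∀ n : ℤ, (shiftFunctor 𝒯 n).Additive] [Pretriangulated 𝒯] [IsTriangulated 𝒯]
    [HasZeroObject 𝒞] [HasShift 𝒞 ℤ] [Preadditive 𝒞]
    [∀ n : ℤ, (shiftFunctor 𝒞 n).Additive] [Pretriangulated 𝒞] [IsTriangulated 𝒞]
    (i : 𝒯 ⥤ 𝒞) (I : 𝒞 ⥤ 𝒯) (Q : 𝒞 ⥤ 𝒯) (K : 𝒞 ⥤ 𝒯) (G : 𝒯 ⥤ 𝒞)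
    [i.CommShift ℤ] [I.CommShift ℤ] [Q.CommShift ℤ] [K.CommShift ℤ] [G.CommShift ℤ]
    [i.IsTriangulated] [I.IsTriangulated] [Q.IsTriangulated] [K.IsTriangulated]
    [G.IsTriangulated]
    (adjQi : Q ⊣ i) (adjiK : i ⊣ K) (adjGI : G ⊣ I)
    (hvanish : ∀ a : 𝒯, IsZero (I.obj (i.obj a)))
    [IsIso adjiK.unit] [IsIso adjQi.counit] [IsIso adjGI.unit]
    (bd : Q ⋙ i ⟶ (I ⋙ G) ⋙ shiftFunctor 𝒞 (1 : ℤ))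
    (htri : ∀ X : 𝒞,
      Triangle.mk (adjGI.counit.app X) (adjQi.unit.app X) (bd.app X) ∈ distTriang 𝒞)
    -- the deformation data, given for every object `X` of `𝒞`
    (γ : ∀ X : 𝒞, K.obj (G.obj (I.obj X)) ⟶ K.obj X)
    (α : ∀ X : 𝒞, K.obj X ⟶ Q.obj X)
    (β : ∀ X : 𝒞, Q.obj X ⟶ (K.obj (G.obj (I.obj X)))⟦(1 : ℤ)⟧)
    (hKGI : ∀ X : 𝒞, Triangle.mk (γ X) (α X) (β X) ∈ distTriang 𝒯)
    (C : 𝒞 → 𝒯)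
    (δ₁ : ∀ X : 𝒞, I.obj X ⟶ K.obj X) (ζ₁ : ∀ X : 𝒞, K.obj X ⟶ C X)
    (η₁ : ∀ X : 𝒞, C X ⟶ (I.obj X)⟦(1 : ℤ)⟧)
    (h₁ : ∀ X : 𝒞, Triangle.mk (δ₁ X) (ζ₁ X) (η₁ X) ∈ distTriang 𝒯)
    (η₂ : ∀ X : 𝒞, C X ⟶ Q.obj X) (δ₂ : ∀ X : 𝒞, Q.obj X ⟶ I.obj X)
    (ζ₂ : ∀ X : 𝒞, I.obj X ⟶ (C X)⟦(1 : ℤ)⟧)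
    (h₂ : ∀ X : 𝒞, Triangle.mk (η₂ X) (δ₂ X) (ζ₂ X) ∈ distTriang 𝒯)
    (hα : ∀ X : 𝒞, ζ₁ X ≫ η₂ X = α X) :
    ∀ Y : 𝒯,
      ∃ (s : Y⟦(1 : ℤ)⟧ ⟶ (K.obj (G.obj Y))⟦(1 : ℤ)⟧)
        (p : (K.obj (G.obj Y))⟦(1 : ℤ)⟧ ⟶ Y),
        Triangle.mk
          -- `μ_Y := ((g_Y)⟦1⟧)⁻¹ ∘ ι_{G Y} ∘ (g_Y)⟦-1⟧` where `ι_X := η₁ ∘ ζ₂⟦-1⟧`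
          ((shiftFunctor 𝒯 (-1 : ℤ)).map (adjGI.unit.app Y) ≫
            ((shiftFunctor 𝒯 (-1 : ℤ)).map (ζ₂ (G.obj Y)) ≫
              (shiftFunctorCompIsoId 𝒯 (1 : ℤ) (-1 : ℤ) (by omega)).hom.app (C (G.obj Y)) ≫
                η₁ (G.obj Y)) ≫
            inv ((shiftFunctor 𝒯 (1 : ℤ)).map (adjGI.unit.app Y)))
          s
          (p ≫ (shiftFunctorCompIsoId 𝒯 (-1 : ℤ) (1 : ℤ) (by omega)).inv.app Y) ∈
          distTriang 𝒯 := by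
  intro Y
  have : IsIso (ζ₂ (G.obj Y)) := (Triangle.isZero₂_iff_isIso₃ _ (h₂ (G.obj Y))).1
    (isZero_leftAdjoint_obj_leftAdjoint_obj adjQi adjGI hvanish Y)
  let g : Y ≅ I.obj (G.obj Y) := asIso (adjGI.unit.app Y)
  let a : Y⟦(-1 : ℤ)⟧ ≅ C (G.obj Y) :=
    (shiftFunctor 𝒯 (-1 : ℤ)).mapIso (g ≪≫ asIso (ζ₂ (G.obj Y))) ≪≫
      (shiftFunctorCompIsoId 𝒯 (1 : ℤ) (-1 : ℤ) (by omega)).app (C (G.obj Y))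
  obtain ⟨s, t, hst⟩ := exists_distinguished_of_iso_rotate_rotate (h₁ (G.obj Y)) a
    ((shiftFunctor 𝒯 (1 : ℤ)).mapIso g)
  refine ⟨s, t ≫ (shiftFunctorCompIsoId 𝒯 (-1 : ℤ) (1 : ℤ) (by omega)).hom.app Y, ?_⟩
  have hb : inv ((shiftFunctor 𝒯 (1 : ℤ)).map (adjGI.unit.app Y)) =
      ((shiftFunctor 𝒯 (1 : ℤ)).mapIso g).inv :=
    IsIso.inv_eq_of_hom_inv_id ((shiftFunctor 𝒯 (1 : ℤ)).mapIso g).hom_inv_id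
  rw [hb]
  simpa [a, g] using hst
end

section
/- Let 𝒯 be a category equipped with a shift by ℤ (shift functors Y ↦ Y⟦n⟧), and let ℰ, ℰ′ be categories. Suppose given functors I : ℰ ⥤ 𝒯, G : 𝒯 ⥤ ℰ, I′ : ℰ′ ⥤ 𝒯, G′ : 𝒯 ⥤ ℰ′, F : ℰ ⥤ ℰ′; natural isomorphisms g : 1_𝒯 ≅ G ⋙ I (components g_Y : Y → I(G Y)), g′ : 1_𝒯 ≅ G′ ⋙ I′, χ_I : I ≅ F ⋙ I′ (components χ_{I,X} : I X → I′(F X)), χ_G : G′ ≅ G ⋙ F (components χ_{G,Y} : G′ Y → F(G Y)); and families of morphisms ι_X : (I X)⟦−1⟧ → (I X)⟦1⟧ natural in X ∈ ℰ and ι′_{X′} : (I′ X′)⟦−1⟧ → (I′ X′)⟦1⟧ natural in X′ ∈ ℰ′. Assume: (i) (compatibility of units) for every object Y of 𝒯, I′(χ_{G,Y}) ∘ g′_Y = χ_{I,G Y} ∘ g_Y as morphisms Y → I′(F(G Y)); (ii) (equivalence of deformation classes) for every object X of ℰ, (χ_{I,X})⟦1⟧ ∘ ι_X = ι′_{F X}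 ∘ (χ_{I,X})⟦−1⟧. Define μ_Y := ((g_Y)⟦1⟧)⁻¹ ∘ ι_{G Y} ∘ (g_Y)⟦−1⟧ : Y⟦−1⟧ → Y⟦1⟧ and μ′_Y := ((g′_Y)⟦1⟧)⁻¹ ∘ ι′_{G′ Y} ∘ (g′_Y)⟦−1⟧ : Y⟦−1⟧ → Y⟦1⟧. Then μ_Y = μ′_Y for every object Y of 𝒯. -/
open CategoryTheory Category Limits

/-- Equivalent categorical deformations determine the same Hochschild class:
given functors `I, G, I', G', F`, natural isomorphisms `g : 𝟭 𝒯 ≅ G ⋙ I`,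
`g' : 𝟭 𝒯 ≅ G' ⋙ I'`, `χ_I : I ≅ F ⋙ I'`, `χ_G : G' ≅ G ⋙ F`, and natural families
`ι : I⟦-1⟧ ⟶ I⟦1⟧`, `ι' : I'⟦-1⟧ ⟶ I'⟦1⟧`, if (i) the units are compatible,
`I'(χ_{G,Y}) ∘ g'_Y = χ_{I,G Y} ∘ g_Y`, and (ii) the classes are equivalent,
`(χ_{I,X})⟦1⟧ ∘ ι_X = ι'_{F X} ∘ (χ_{I,X})⟦-1⟧`, then the induced classes
`μ_Y := ((g_Y)⟦1⟧)⁻¹ ∘ ι_{G Y} ∘ (g_Y)⟦-1⟧` and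
`μ'_Y := ((g'_Y)⟦1⟧)⁻¹ ∘ ι'_{G' Y} ∘ (g'_Y)⟦-1⟧` agree for every object `Y` of `𝒯`. -/
theorem mu_eq_of_equivalence_of_deformations
    {𝒯 : Type*} [Category 𝒯] [HasShift 𝒯 ℤ]
    {ℰ ℰ' : Type*} [Category ℰ] [Category ℰ']
    (I : ℰ ⥤ 𝒯) (G : 𝒯 ⥤ ℰ) (I' : ℰ' ⥤ 𝒯) (G' : 𝒯 ⥤ ℰ') (F : ℰ ⥤ ℰ')
    (g : 𝟭 𝒯 ≅ G ⋙ I) (g' : 𝟭 𝒯 ≅ G' ⋙ I')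
    (χI : I ≅ F ⋙ I') (χG : G' ≅ G ⋙ F)
    (ι : I ⋙ shiftFunctor 𝒯 (-1 : ℤ) ⟶ I ⋙ shiftFunctor 𝒯 (1 : ℤ))
    (ι' : I' ⋙ shiftFunctor 𝒯 (-1 : ℤ) ⟶ I' ⋙ shiftFunctor 𝒯 (1 : ℤ))
    (hunit : ∀ Y : 𝒯,
      g'.hom.app Y ≫ I'.map (χG.hom.app Y) = g.hom.app Y ≫ χI.hom.app (G.obj Y))
    (hclass : ∀ X : ℰ,
      ι.app X ≫ (shiftFunctor 𝒯 (1 : ℤ)).map (χI.hom.app X) =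
        (shiftFunctor 𝒯 (-1 : ℤ)).map (χI.hom.app X) ≫ ι'.app (F.obj X)) :
    ∀ Y : 𝒯,
      (shiftFunctor 𝒯 (-1 : ℤ)).map (g.hom.app Y) ≫ ι.app (G.obj Y) ≫
          (shiftFunctor 𝒯 (1 : ℤ)).map (g.inv.app Y) =
        (shiftFunctor 𝒯 (-1 : ℤ)).map (g'.hom.app Y) ≫ ι'.app (G'.obj Y) ≫
          (shiftFunctor 𝒯 (1 : ℤ)).map (g'.inv.app Y) := by
  intro Y
  have hnat := ι'.naturality (χG.hom.app Y)
  have hg : g.inv.app Y ≫ g.hom.app Y = 𝟙 _ := g.inv_hom_id_app Y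
  have hg' : g'.inv.app Y ≫ g'.hom.app Y = 𝟙 _ := g'.inv_hom_id_app Y
  have hu := hunit Y
  rw [← cancel_mono ((shiftFunctor 𝒯 (1 : ℤ)).map (g.hom.app Y ≫ χI.hom.app (G.obj Y)))]
  trans (shiftFunctor 𝒯 (-1 : ℤ)).map (g.hom.app Y ≫ χI.hom.app (G.obj Y)) ≫
    ι'.app (F.obj (G.obj Y))
  · dsimp only [Functor.comp_obj, Functor.comp_map, Functor.id_obj] at *
    simp only [assoc, ← Functor.map_comp, reassoc_of% hg, hclass]
    simp only [Functor.map_comp, assoc]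
  · rw [← hu]
    dsimp only [Functor.comp_obj, Functor.comp_map, Functor.id_obj] at *
    simp only [assoc, ← Functor.map_comp, reassoc_of% hg']
    simp only [Functor.map_comp, assoc, hnat]
end
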